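/- Let f ∈ ℤ[x₁, …, x_n] (viewed inside P). Then f lies in the ideal J_n of ℤ[x₁, …, x_n] generated by the quasisymmetric polynomials with zero constant term if and only if Φ_Ω(f) = 0 for every Ω ∈ RTSeq_n. -/

import Mathlib

/-!
Statement 18.  `P = ℤ[x₁, x₂, …]` (variables indexed by positive integers), with the
Bergeron–Sottile maps `R_i` and quasisymmetric divided differences `T_i` (characterized
by `x_i·(T_i f) = R_{i+1} f − R_i f`).  The subring `ℤ[x₁, …, x_n]` is modelled as
`MvPolynomial (Fin n) ℤ`, embedded in `P` by `x_s ↦ x_s` (i.e. `rename` along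
`s ↦ s + 1 ∈ ℕ+`).  For `Ω = X₁⋯X_n ∈ RTSeq_n`, `Φ_Ω(f) ∈ ℤ` is the constant
coefficient of `up(X₁)(up(X₂)(⋯ up(X_n)(f)⋯))` with `up(r_j) = R_j`, `up(t_j) = T_j`.
`f ∈ ℤ[x₁,…,x_n]` is quasisymmetric if for all `k ≥ 1`, exponents `a₁,…,a_k ≥ 1` and
`1 ≤ i₁ < ⋯ < i_k ≤ n`, the coefficient of `x_{i₁}^{a₁}⋯x_{i_k}^{a_k}` equals that of
`x₁^{a₁}⋯x_k^{a_k}`; `J_n` is the ideal generated by quasisymmetric polynomials with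
zero constant term.  Claim: `f ∈ J_n` iff `Φ_Ω(f) = 0` for every `Ω ∈ RTSeq_n`.
-/

/-- The polynomial ring `ℤ[x₁, x₂, …]` with variables indexed by the positive integers. -/
abbrev PolyP : Type := MvPolynomial ℕ+ ℤ

/-- The Bergeron–Sottile map `R_i : P → P`,
`f(x₁, x₂, …) ↦ f(x₁, …, x_{i−1}, 0, x_i, x_{i+1}, …)`. -/
noncomputable def Rop (i : ℕ+) : PolyP →ₐ[ℤ] PolyP :=
  MvPolynomial.aeval (fun j : ℕ+ =>
    if j < i then MvPolynomial.X j
    else if j = i then 0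
    else MvPolynomial.X (j - 1))

/-- The formal letters `r_j, t_j` (`j ≥ 1`); `RTLetter.r k` stands for `r_{k+1}`,
`RTLetter.t k` for `t_{k+1}`. -/
inductive RTLetter : Type
  | r : ℕ → RTLetter
  | t : ℕ → RTLetter
deriving DecidableEq

/-- The letter at (0-indexed) position `p` of a sequence in `RTSeq_n` must lie in
`{r₁, t₁, …, r_p, t_p, r_{p+1}}` (1-indexed position `s = p+1`). -/
def validLetter (p : ℕ) : RTLetter → Prop
  | .r k => k ≤ p
  | .t k => k + 1 ≤ p

/-- `Ω ∈ RTSeq_n`: a sequence of `n` letters `X₁⋯X_n` with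
`X_s ∈ {r₁, t₁, …, r_{s−1}, t_{s−1}, r_s}`. -/
def validSeq (n : ℕ) (L : List RTLetter) : Prop :=
  L.length = n ∧ ∀ p < L.length, validLetter p (L.getD p (.r 0))

/-- `up(X₁)(up(X₂)(⋯ up(X_n)(f)⋯))`, where `up(r_j) = R_j` and `up(t_j) = T_j`. -/
noncomputable def applyOps (T : ℕ+ → PolyP →ₗ[ℤ] PolyP) (L : List RTLetter) (f : PolyP) :
    PolyP :=
  L.foldr (fun X g => match X with
    | .r k => Rop k.succPNat g
    | .t k => T k.succPNat g) f

/-- The embedding `ℤ[x₁,…,x_n] → P`, `x_s ↦ x_s` (variable `s : Fin n` goes to the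
positive integer `s + 1`). -/
noncomputable def emb (n : ℕ) : MvPolynomial (Fin n) ℤ →ₐ[ℤ] PolyP :=
  MvPolynomial.rename (fun s : Fin n => (s : ℕ).succPNat)

/-- Quasisymmetry of `f ∈ ℤ[x₁,…,x_n]`: for every `k ≥ 1` (necessarily `k ≤ n`),
exponents `a₁,…,a_k ≥ 1` and strictly increasing `1 ≤ i₁ < ⋯ < i_k ≤ n`, the coefficient
of `x_{i₁}^{a₁}⋯x_{i_k}^{a_k}` equals that of `x₁^{a₁}⋯x_k^{a_k}`. -/
def IsQSym (n : ℕ) (f : MvPolynomial (Fin n) ℤ) : Prop :=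
  ∀ (k : ℕ), 1 ≤ k → ∀ (hk : k ≤ n) (a : Fin k → ℕ), (∀ s, 1 ≤ a s) →
    ∀ idx : Fin k → Fin n, StrictMono idx →
      MvPolynomial.coeff (∑ s : Fin k, Finsupp.single (idx s) (a s)) f =
        MvPolynomial.coeff (∑ s : Fin k, Finsupp.single (Fin.castLE hk s) (a s)) f

namespace QuasisymmetricIdeal

open MvPolynomial

/-! ### The Aval–Bergeron–Bergeron recursion over an arbitrary commutative ring -/

section Recursion

variable {R S : Type*} [CommRing R] [CommRing S]

/-- Effect of a zero exponent on a family indexed by compositions.  A list `v` stands for the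
composition whose parts are `a + 1` for `a ∈ v`. -/
def zeroStep (x : R) (φ : List ℕ → R) : List ℕ → R
  | [] => φ []
  | 0 :: v => φ (0 :: v) - x * zeroStep x φ v
  | (a + 1) :: v => φ ((a + 1) :: v) - x * φ (a :: v)

/-- Reads an exponent vector from left to right, transforming a family indexed by compositions,
and evaluates the final family at the empty composition. -/
def process : (ℕ → R) → List ℕ → (List ℕ → R) → R
  | _, [], φ => φ []
  | x, 0 :: ε, φ => process (fun i => x (i + 1)) ε (zeroStep (x 0) φ)
  | x, (b + 1) :: ε, φ => process (fun i => x (i + 1)) ε (fun v => φ (b :: v))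

theorem map_zeroStep (f : R →+* S) (x : R) (φ : List ℕ → R) (v : List ℕ) :
    f (zeroStep x φ v) = zeroStep (f x) (fun w => f (φ w)) v := by
  induction v with
  | nil => rfl
  | cons a v ih => cases a <;> simp [zeroStep, ih]

theorem map_process (f : R →+* S) (ε : List ℕ) (x : ℕ → R) (φ : List ℕ → R) :
    f (process x ε φ) = process (fun i => f (x i)) ε (fun w => f (φ w)) := by
  induction ε generalizing x φ with
  | nil => rfl
  | cons b ε ih => cases b <;> simp [process, ih, map_zeroStep]

theorem zeroStep_mul_add (x c : R) (φ ψ : List ℕ → R) (v : List ℕ) :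
    zeroStep x (fun w => c * φ w + ψ w) v = c * zeroStep x φ v + zeroStep x ψ v := by
  induction v with
  | nil => rfl
  | cons a v ih =>
    cases a
    · simp only [zeroStep, ih]; ring
    · simp only [zeroStep]; ring

theorem process_mul_add (c : R) (ε : List ℕ) (x : ℕ → R) (φ ψ : List ℕ → R) :
    process x ε (fun w => c * φ w + ψ w) = c * process x ε φ + process x ε ψ := by
  induction ε generalizing x φ ψ with
  | nil => rfl
  | cons b ε ih =>
    cases b
    · simp only [process, ← ih]
      congr 1
      funext v
      exact zeroStep_mul_add _ _ _ _ _
    · simp only [process, ih]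

/-- Some nonempty prefix of length `k` of the list has sum at least `k + m`. -/
def Exceeds : ℕ → List ℕ → Prop
  | _, [] => False
  | m, b :: ε => m < b ∨ Exceeds (m + 1 - b) ε

theorem Exceeds.mono {m m' : ℕ} (h : m' ≤ m) {ε : List ℕ} (hε : Exceeds m ε) :
    Exceeds m' ε := by
  induction ε generalizing m m' with
  | nil => exact hε
  | cons b ε ih =>
    rcases hε with hb | hb
    · exact Or.inl (by omega)
    · exact Or.inr (ih (by omega) hb)

theorem zeroStep_mem_of_forall {I : Ideal R} {φ : List ℕ → R} (hφ : ∀ v, φ v ∈ I) (x : R)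
    (v : List ℕ) : zeroStep x φ v ∈ I := by
  induction v with
  | nil => exact hφ _
  | cons a v ih =>
    cases a
    · exact I.sub_mem (hφ _) (I.mul_mem_left _ ih)
    · exact I.sub_mem (hφ _) (I.mul_mem_left _ (hφ _))

theorem process_mem_of_forall {I : Ideal R} (ε : List ℕ) (x : ℕ → R) {φ : List ℕ → R}
    (hφ : ∀ v, φ v ∈ I) : process x ε φ ∈ I := by
  induction ε generalizing x φ with
  | nil => exact hφ _
  | cons b ε ih =>
    cases b
    · exact ih _ (zeroStep_mem_of_forall hφ _)
    · exact ih _ (fun v => hφ _)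

theorem zeroStep_mem {I : Ideal R} {φ : List ℕ → R} {m : ℕ}
    (hφ : ∀ v : List ℕ, Exceeds m (v.map (· + 1)) → φ v ∈ I) (x : R) (v : List ℕ)
    (hv : Exceeds (m + 1) (v.map (· + 1))) : zeroStep x φ v ∈ I := by
  induction v with
  | nil => exact hv.elim
  | cons a v ih =>
    have h₁ := hφ _ (hv.mono (Nat.le_succ m))
    cases a with
    | zero =>
      refine I.sub_mem h₁ (I.mul_mem_left _ (ih ?_))
      simp only [List.map_cons, Exceeds] at hv
      rcases hv with hb | hb
      · omega
      · exact hb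
    | succ a =>
      refine I.sub_mem h₁ (I.mul_mem_left _ (hφ _ ?_))
      simp only [List.map_cons, Exceeds] at hv ⊢
      rcases hv with hb | hb
      · exact Or.inl (by omega)
      · exact Or.inr (hb.mono (by omega))

theorem process_mem {I : Ideal R} (ε : List ℕ) (x : ℕ → R) {φ : List ℕ → R} {m : ℕ}
    (hφ : ∀ v : List ℕ, Exceeds m (v.map (· + 1)) → φ v ∈ I) (hε : Exceeds m ε) :
    process x ε φ ∈ I := by
  induction ε generalizing x φ m with
  | nil => exact hε.elim
  | cons b ε ih =>
    cases b with
    | zero =>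
      rcases hε with hb | hb
      · omega
      · exact ih _ (zeroStep_mem hφ _) hb
    | succ b =>
      rcases hε with hb | hb
      · exact process_mem_of_forall (φ := fun v => φ (b :: v)) _ _ (fun v => hφ _ (Or.inl hb))
      · exact ih _ (fun v hv => hφ (b :: v) (Or.inr hv)) hb

end Recursion

/-! ### Removing and inserting variables -/

/-- The ring `ℤ[x₁, …, x_n]`. -/
abbrev Pol (n : ℕ) : Type := MvPolynomial (Fin n) ℤ

/-- Shift of variables `x_i ↦ x_{i+1}`. -/
noncomputable def shift (n : ℕ) : Pol n →ₐ[ℤ] Pol (n + 1) := rename Fin.succ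

/-- The Bergeron–Sottile map on finitely many variables. -/
noncomputable def rop {n : ℕ} (i : Fin (n + 1)) : Pol (n + 1) →ₐ[ℤ] Pol n :=
  aeval (i.insertNth (α := fun _ => Pol n) 0 X)

@[simp] theorem shift_X {n : ℕ} (i : Fin n) : shift n (X i) = X i.succ := by simp [shift]

@[simp] theorem rop_X_self {n : ℕ} (i : Fin (n + 1)) : rop i (X i) = 0 := by simp [rop]

@[simp] theorem rop_X_succAbove {n : ℕ} (i : Fin (n + 1)) (j : Fin n) :
    rop i (X (i.succAbove j)) = X j := by simp [rop]

theorem rop_zero_shift {n : ℕ} (p : Pol n) : rop 0 (shift n p) = p := by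
  have : (rop 0).comp (shift n) = AlgHom.id ℤ (Pol n) := by
    ext1 j
    simpa using rop_X_succAbove 0 j
  exact DFunLike.congr_fun this p

theorem rop_succ_X_zero {n : ℕ} (i : Fin (n + 1)) : rop i.succ (X 0) = X 0 := by
  simpa using rop_X_succAbove i.succ 0

theorem rop_succ_shift {n : ℕ} (i : Fin (n + 1)) (p : Pol (n + 1)) :
    rop i.succ (shift (n + 1) p) = shift n (rop i p) := by
  have : (rop i.succ).comp (shift (n + 1)) = (shift n).comp (rop i) := by
    ext1 j
    induction j using i.succAboveCases with
    | x => simp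
    | p j => simpa using rop_X_succAbove i.succ j.succ
  exact DFunLike.congr_fun this p

theorem coeff_rop {n : ℕ} (i : Fin (n + 1)) (p : Pol (n + 1)) (d : Fin n →₀ ℕ) :
    coeff d (rop i p) = coeff (d.mapDomain i.succAbove) p := by
  classical
  have key : ∀ q : Pol n, coeff d q = coeff (d.mapDomain i.succAbove) (rename i.succAbove q) :=
    fun q => (coeff_rename_mapDomain _ Fin.succAbove_right_injective q d).symm
  have hi : (d.mapDomain i.succAbove) i = 0 :=
    Finsupp.mapDomain_of_notMem_range _ _ (by simp)
  have dvd : ∃ q, p = rename i.succAbove (rop i p) + X i * q := by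
    induction p using MvPolynomial.induction_on with
    | C c => exact ⟨0, by simp [rop]⟩
    | add p q hp hq =>
      obtain ⟨a, ha⟩ := hp
      obtain ⟨b, hb⟩ := hq
      exact ⟨a + b, by rw [map_add, map_add]; linear_combination ha + hb⟩
    | mul_X p j hp =>
      obtain ⟨a, ha⟩ := hp
      induction j using i.succAboveCases with
      | x => exact ⟨p, by simp [mul_comm]⟩
      | p j =>
        refine ⟨a * X (i.succAbove j), ?_⟩
        simp only [map_mul, rop_X_succAbove, rename_X]
        linear_combination X (i.succAbove j) * ha
  obtain ⟨q, hq⟩ := dvd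
  conv_rhs => rw [hq]
  rw [coeff_add, ← key, coeff_X_mul', if_neg (by simp [hi]), add_zero]

/-! ### Quasisymmetric polynomials -/

theorem coeff_rop_sum {n k : ℕ} (i : Fin (n + 1)) (p : Pol (n + 1)) (idx : Fin k → Fin n)
    (a : Fin k → ℕ) : coeff (∑ s, Finsupp.single (idx s) (a s)) (rop i p) =
      coeff (∑ s, Finsupp.single (i.succAbove (idx s)) (a s)) p := by
  rw [coeff_rop, Finsupp.mapDomain_finsetSum]
  simp only [Finsupp.mapDomain_single]

theorem exists_eq_sum_single {n : ℕ} (d : Fin n →₀ ℕ) :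
    ∃ (k : ℕ) (_ : k ≤ n) (a : Fin k → ℕ) (idx : Fin k → Fin n), (∀ s, 1 ≤ a s) ∧
      StrictMono idx ∧ d = ∑ s, Finsupp.single (idx s) (a s) := by
  let e := d.support.orderIsoOfFin rfl
  refine ⟨d.support.card, by simpa using d.support.card_le_univ, fun s => d (e s),
    fun s => e s, fun s => ?_, fun s t h => e.strictMono h, ?_⟩
  · exact Nat.one_le_iff_ne_zero.mpr (Finsupp.mem_support_iff.mp (e s).2)
  · have h := e.toEquiv.sum_comp (fun j : d.support => Finsupp.single (j : Fin n) (d j))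
    refine Eq.trans ?_ h.symm
    rw [Finset.sum_coe_sort d.support (fun j => Finsupp.single j (d j))]
    exact d.sum_single.symm

theorem rop_eq_rop_of_isQSym {n : ℕ} {h : Pol (n + 1)} (hh : IsQSym (n + 1) h)
    (i j : Fin (n + 1)) : rop i h = rop j h := by
  ext d
  obtain ⟨k, hk, a, idx, ha, hidx, rfl⟩ := exists_eq_sum_single d
  rw [coeff_rop_sum, coeff_rop_sum]
  rcases Nat.eq_zero_or_pos k with rfl | hk0
  · simp
  · have hk' : k ≤ n + 1 := by omega
    exact (hh k hk0 hk' a ha _ ((Fin.strictMono_succAbove i).comp hidx)).trans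
      (hh k hk0 hk' a ha _ ((Fin.strictMono_succAbove j).comp hidx)).symm

theorem isQSym_rop {n : ℕ} {h : Pol (n + 1)} (hh : IsQSym (n + 1) h) (i : Fin (n + 1)) :
    IsQSym n (rop i h) := by
  intro k hk0 hk a ha idx hidx
  rw [coeff_rop_sum, coeff_rop_sum]
  have hk' : k ≤ n + 1 := by omega
  exact (hh k hk0 hk' a ha _ ((Fin.strictMono_succAbove i).comp hidx)).trans
    (hh k hk0 hk' a ha _
      ((Fin.strictMono_succAbove i).comp (Fin.strictMono_castLE hk))).symm

theorem isQSym_of_rop_eq {n : ℕ} {h : Pol (n + 1)} {g : Pol n} (hg : IsQSym n g)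
    (H : ∀ i, rop i h = g) : IsQSym (n + 1) h := by
  have key : ∀ (k : ℕ), 1 ≤ k → ∀ (hk : k ≤ n) (a : Fin k → ℕ), (∀ s, 1 ≤ a s) →
      ∀ idx : Fin k → Fin (n + 1), StrictMono idx →
        coeff (∑ s, Finsupp.single (idx s) (a s)) h =
          coeff (∑ s, Finsupp.single (Fin.castLE hk s) (a s)) g := by
    intro k hk0 hk a ha idx hidx
    obtain ⟨i, hi⟩ : ∃ i, i ∉ Set.range idx := by
      by_contra! hcon
      have := Fintype.card_le_of_surjective idx hcon
      simp at this
      omega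
    have hne : ∀ s, ∃ t, i.succAbove t = idx s := fun s =>
      Fin.exists_succAbove_eq (fun hs => hi ⟨s, hs⟩)
    choose idx' hidx' using hne
    have hmono : StrictMono idx' := fun s t hst => by
      have := hidx hst
      rw [← hidx', ← hidx'] at this
      exact (Fin.strictMono_succAbove i).lt_iff_lt.mp this
    rw [← hg k hk0 hk a ha idx' hmono, ← H i, coeff_rop_sum]
    simp only [hidx']
  intro k hk0 hk a ha idx hidx
  rcases Nat.lt_or_ge n k with hlt | hle
  · obtain rfl : k = n + 1 := by omega
    have hid : idx = Fin.castLE hk := by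
      refine (StrictMono.range_inj hidx (Fin.strictMono_castLE hk)).mp ?_
      rw [(Finite.surjective_of_injective hidx.injective).range_eq,
        (Finite.surjective_of_injective (Fin.strictMono_castLE hk).injective).range_eq]
    rw [hid]
  · rw [key k hk0 hle a ha idx hidx, key k hk0 hle a ha _ (Fin.strictMono_castLE hk)]

/-! ### Fundamental quasisymmetric polynomials -/

/-- Recursion step for fundamental quasisymmetric polynomials. -/
noncomputable def fundStep {n : ℕ} (prev : List ℕ → Pol n) : ℕ → List ℕ → Pol (n + 1)
  | 0, v => X 0 * shift n (prev v) + shift n (prev (0 :: v))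
  | a + 1, v => X 0 * fundStep prev a v + shift n (prev ((a + 1) :: v))

/-- The fundamental quasisymmetric polynomial in `n` variables whose composition has parts
`a + 1` for `a ∈ v`. -/
noncomputable def fund : ∀ n : ℕ, List ℕ → Pol n
  | 0, [] => 1
  | 0, _ :: _ => 0
  | _ + 1, [] => 1
  | n + 1, a :: v => fundStep (fund n) a v

theorem fund_nil (n : ℕ) : fund n [] = 1 := by cases n <;> rfl

theorem rop_fund {n : ℕ} (i : Fin (n + 1)) (v : List ℕ) : rop i (fund (n + 1) v) = fund n v := by
  induction n generalizing v with
  | zero =>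
    obtain rfl := Fin.fin_one_eq_zero i
    cases v with
    | nil => simp [fund]
    | cons a v => cases a <;> simp [fund, fundStep, rop_zero_shift]
  | succ n ih =>
    cases v with
    | nil => simp [fund]
    | cons a v =>
      induction i using Fin.cases with
      | zero =>
        change rop 0 (fundStep (fund (n + 1)) a v) = fund (n + 1) (a :: v)
        cases a <;> simp [fundStep, rop_zero_shift]
      | succ i =>
        change rop i.succ (fundStep (fund (n + 1)) a v) = fundStep (fund n) a v
        induction a with
        | zero => simp [fundStep, -Fin.succ_zero_eq_one, rop_succ_X_zero, rop_succ_shift, ih]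
        | succ a iha => simp [fundStep, rop_succ_X_zero, rop_succ_shift, ih, iha]

theorem isQSym_fund (n : ℕ) (v : List ℕ) : IsQSym n (fund n v) := by
  induction n with
  | zero => intro k hk0 hk; omega
  | succ n ih => exact isQSym_of_rop_eq ih (fun i => rop_fund i v)

theorem constantCoeff_rop {n : ℕ} (i : Fin (n + 1)) (p : Pol (n + 1)) :
    constantCoeff (rop i p) = constantCoeff p := by
  simpa [constantCoeff_eq] using coeff_rop i p 0

theorem constantCoeff_fund_cons (n a : ℕ) (v : List ℕ) :
    constantCoeff (fund n (a :: v)) = 0 := by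
  induction n with
  | zero => simp [fund]
  | succ n ih => rw [← constantCoeff_rop 0, rop_fund, ih]

theorem zeroStep_fund (n : ℕ) (v : List ℕ) :
    zeroStep (X 0) (fund (n + 1)) v = shift n (fund n v) := by
  induction v with
  | nil => simp [zeroStep, fund_nil]
  | cons a v ih =>
    cases a with
    | zero => simp [zeroStep, ih, fund, fundStep]
    | succ a => simp [zeroStep, fund, fundStep]

/-! ### The spanning family -/

/-- The `i`-th variable (counted from zero), or zero if there is none. -/
noncomputable def var (n i : ℕ) : Pol n := if h : i < n then X ⟨i, h⟩ else 0

theorem var_succ (n i : ℕ) : var (n + 1) (i + 1) = shift n (var n i) := by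
  unfold var
  by_cases h : i < n <;> simp [h]

/-- The Aval–Bergeron–Bergeron polynomial attached to an exponent vector. -/
noncomputable def abb (n : ℕ) (ε : List ℕ) : Pol n := process (var n) ε (fund n)

theorem abb_zero_cons (n : ℕ) (ε : List ℕ) : abb (n + 1) (0 :: ε) = shift n (abb n ε) := by
  have h := map_process (shift n : Pol n →+* Pol (n + 1)) ε (var n) (fund n)
  simp only [RingHom.coe_coe] at h
  rw [abb, abb, h, process]
  have hz : var (n + 1) 0 = X 0 := by simp [var]
  rw [hz, funext (zeroStep_fund n), funext (var_succ n)]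

theorem abb_succ_cons (n b : ℕ) (ε : List ℕ) : ∃ r,
    abb (n + 1) ((b + 1) :: ε) = X 0 * abb (n + 1) (b :: ε) + shift n r := by
  refine ⟨process (var n) ε (fun v => fund n (b :: v)), ?_⟩
  have h := map_process (shift n : Pol n →+* Pol (n + 1)) ε (var n) (fun v => fund n (b :: v))
  simp only [RingHom.coe_coe] at h
  rw [h]
  cases b with
  | zero =>
    have h' := map_process (shift n : Pol n →+* Pol (n + 1)) ε (var n) (fund n)
    simp only [RingHom.coe_coe] at h'
    rw [abb_zero_cons, abb, abb, h', process, ← process_mul_add, funext (var_succ n)]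
    rfl
  | succ b =>
    rw [abb, abb, process, process, funext (var_succ n), ← process_mul_add]
    rfl

/-- Multiplication by `x₁ ^ b` after a shift of variables. -/
noncomputable def lead (n b : ℕ) : Pol n →ₗ[ℤ] Pol (n + 1) :=
  LinearMap.mulLeft ℤ (X 0 ^ b) ∘ₗ (shift n).toLinearMap

theorem lead_apply (n b : ℕ) (p : Pol n) : lead n b p = X 0 ^ b * shift n p := rfl

theorem abb_sub_lead_mem (n b : ℕ) (ε : List ℕ) :
    abb (n + 1) (b :: ε) - lead n b (abb n ε) ∈ ⨆ j < b, LinearMap.range (lead n j) := by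
  induction b with
  | zero => simp [abb_zero_cons, lead_apply]
  | succ b ih =>
    obtain ⟨r, hr⟩ := abb_succ_cons n b ε
    have h₁ : (⨆ j < b, LinearMap.range (lead n j)) ≤
        (⨆ j < b + 1, LinearMap.range (lead n j)).comap (LinearMap.mulLeft ℤ (X 0)) := by
      refine iSup₂_le fun j hj => ?_
      rintro _ ⟨p, rfl⟩
      refine Submodule.mem_iSup_of_mem (j + 1) (Submodule.mem_iSup_of_mem (by omega) ⟨p, ?_⟩)
      simp only [lead_apply, LinearMap.mulLeft_apply]
      ring
    have h₂ : shift n r ∈ ⨆ j < b + 1, LinearMap.range (lead n j) :=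
      Submodule.mem_iSup_of_mem 0 (Submodule.mem_iSup_of_mem (by omega) ⟨r, by simp [lead_apply]⟩)
    convert Submodule.add_mem _ (Submodule.mem_comap.mp (h₁ ih)) h₂ using 1
    rw [hr, LinearMap.mulLeft_apply, lead_apply, lead_apply]
    ring

theorem eq_top_of_range_lead_le {n : ℕ} {W : Submodule ℤ (Pol (n + 1))}
    (h : ∀ b, LinearMap.range (lead n b) ≤ W) : W = ⊤ := by
  have hX : ∀ p : Pol (n + 1), p ∈ ⨆ b, LinearMap.range (lead n b) := by
    intro p
    induction p using MvPolynomial.induction_on with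
    | C c => exact Submodule.mem_iSup_of_mem 0 ⟨C c, by simp [lead_apply, shift]⟩
    | add p q hp hq => exact Submodule.add_mem _ hp hq
    | mul_X p j hp =>
      have hle : (⨆ b, LinearMap.range (lead n b)) ≤
          (⨆ b, LinearMap.range (lead n b)).comap (LinearMap.mulRight ℤ (X j)) := by
        refine iSup_le fun b => ?_
        rintro _ ⟨p, rfl⟩
        induction j using Fin.cases with
        | zero =>
          refine Submodule.mem_iSup_of_mem (b + 1) ⟨p, ?_⟩
          simp only [lead_apply, LinearMap.mulRight_apply]
          ring
        | succ j =>
          refine Submodule.mem_iSup_of_mem b ⟨p * X j, ?_⟩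
          simp only [lead_apply, LinearMap.mulRight_apply, map_mul, shift_X]
          ring
      exact hle hp
  exact top_unique fun p _ => iSup_le h (hX p)

theorem eq_top_of_abb_mem {n : ℕ} {W : Submodule ℤ (Pol n)} (h : ∀ ε, abb n ε ∈ W) :
    W = ⊤ := by
  induction n with
  | zero =>
    refine top_unique fun p _ => ?_
    rw [eq_C_of_isEmpty p]
    simpa [abb, process, fund, ← smul_eq_C_mul] using W.smul_mem (coeff 0 p) (h [])
  | succ n ih =>
    refine eq_top_of_range_lead_le fun b => ?_
    induction b using Nat.strong_induction_on with
    | _ b ihb =>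
      rw [LinearMap.range_le_iff_comap]
      refine ih fun ε => ?_
      have := W.sub_mem (h (b :: ε)) (iSup₂_le ihb (abb_sub_lead_mem n b ε))
      simpa using this

/-- The span of the monomials `x^ε` such that no nonempty prefix of `ε` of length `k` has sum
at least `k + m`. -/
noncomputable def dyck : ∀ n : ℕ, ℕ → Submodule ℤ (Pol n)
  | 0, _ => ⊤
  | n + 1, 0 => (dyck n 1).map (shift n).toLinearMap
  | n + 1, m + 1 => (dyck n (m + 2)).map (shift n).toLinearMap ⊔
      (dyck (n + 1) m).map (LinearMap.mulLeft ℤ (X 0))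

theorem lead_mem_dyck {n b m : ℕ} (hb : b ≤ m) {p : Pol n} (hp : p ∈ dyck n (m + 1 - b)) :
    lead n b p ∈ dyck (n + 1) m := by
  induction b generalizing m with
  | zero =>
    have hs : lead n 0 p = (shift n).toLinearMap p := by simp [lead_apply]
    rw [hs]
    cases m with
    | zero => rw [dyck]; exact Submodule.mem_map_of_mem hp
    | succ m => rw [dyck]; exact Submodule.mem_sup_left (Submodule.mem_map_of_mem hp)
  | succ b ih =>
    obtain ⟨m, rfl⟩ : ∃ k, m = k + 1 := ⟨m - 1, by omega⟩
    rw [dyck]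
    refine Submodule.mem_sup_right ⟨lead n b p, ih (by omega) ?_, ?_⟩
    · rwa [show m + 1 - b = m + 1 + 1 - (b + 1) by omega]
    · rw [LinearMap.mulLeft_apply, lead_apply, lead_apply]
      ring

theorem eq_top_of_dyck_le {n m : ℕ} {W : Submodule ℤ (Pol n)} (hd : dyck n m ≤ W)
    (h : ∀ ε, Exceeds m ε → abb n ε ∈ W) : W = ⊤ := by
  induction n generalizing m with
  | zero => rw [dyck] at hd; exact top_unique hd
  | succ n ih =>
    refine eq_top_of_range_lead_le fun b => ?_
    induction b using Nat.strong_induction_on with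
    | _ b ihb =>
      rw [LinearMap.range_le_iff_comap]
      have key : ∀ ε, Exceeds m (b :: ε) → abb n ε ∈ W.comap (lead n b) := fun ε hε => by
        have := W.sub_mem (h (b :: ε) hε) (iSup₂_le ihb (abb_sub_lead_mem n b ε))
        simpa using this
      rcases Nat.lt_or_ge m b with hb | hb
      · exact eq_top_of_abb_mem fun ε => key ε (Or.inl hb)
      · exact ih (fun p hp => hd (lead_mem_dyck hb hp)) fun ε hε => key ε (Or.inr hε)

/-- The ideal generated by quasisymmetric polynomials without constant term. -/
noncomputable abbrev qsymIdeal (n : ℕ) : Ideal (Pol n) :=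
  Ideal.span {g : Pol n | IsQSym n g ∧ constantCoeff g = 0}

theorem abb_mem_qsymIdeal {n : ℕ} {ε : List ℕ} (hε : Exceeds 0 ε) : abb n ε ∈ qsymIdeal n := by
  refine process_mem ε _ (fun v hv => ?_) hε
  cases v with
  | nil => exact hv.elim
  | cons a v => exact Ideal.subset_span ⟨isQSym_fund _ _, constantCoeff_fund_cons _ _ _⟩

theorem exists_dyck_sub_mem {n : ℕ} (f : Pol n) : ∃ d ∈ dyck n 0, f - d ∈ qsymIdeal n := by
  have htop : dyck n 0 ⊔ (qsymIdeal n).restrictScalars ℤ = ⊤ :=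
    eq_top_of_dyck_le le_sup_left fun ε hε => Submodule.mem_sup_right (abb_mem_qsymIdeal hε)
  obtain ⟨d, hd, j, hj, rfl⟩ := Submodule.mem_sup.mp (htop ▸ Submodule.mem_top : f ∈ _)
  exact ⟨d, hd, by simpa using hj⟩

/-! ### Quasisymmetric divided differences on finitely many variables -/

theorem X_dvd_rop_X_sub {n : ℕ} (i : Fin n) (j : Fin (n + 1)) :
    (X i : Pol n) ∣ rop i.succ (X j) - rop i.castSucc (X j) := by
  induction j using i.castSucc.succAboveCases with
  | x =>
    have h : i.castSucc = i.succ.succAbove i := by simp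
    rw [rop_X_self, sub_zero, h, rop_X_succAbove]
  | p j =>
    rw [rop_X_succAbove]
    by_cases hj : j = i
    · subst hj
      have h : j.castSucc.succAbove j = j.succ := by simp
      rw [h, rop_X_self, zero_sub, dvd_neg]
    · have h : i.castSucc.succAbove j = i.succ.succAbove j := by
        have : (j : ℕ) ≠ i := fun h => hj (Fin.ext h)
        ext
        simp only [Fin.succAbove, Fin.lt_def, Fin.val_castSucc, Fin.val_succ]
        split_ifs <;> simp <;> omega
      rw [h, rop_X_succAbove, sub_self]
      exact dvd_zero _

theorem X_dvd_rop_sub {n : ℕ} (i : Fin n) (f : Pol (n + 1)) :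
    (X i : Pol n) ∣ rop i.succ f - rop i.castSucc f := by
  induction f using MvPolynomial.induction_on with
  | C c => simp [rop]
  | add p q hp hq =>
    rw [map_add, map_add, add_sub_add_comm]
    exact dvd_add hp hq
  | mul_X p j hp =>
    rw [map_mul, map_mul]
    obtain ⟨a, ha⟩ := hp
    obtain ⟨b, hb⟩ := X_dvd_rop_X_sub i j
    refine ⟨a * rop i.succ (X j) + rop i.castSucc p * b, ?_⟩
    linear_combination rop i.succ (X j) * ha + rop i.castSucc p * hb

theorem rop_mem_qsymIdeal {n : ℕ} (i : Fin (n + 1)) {f : Pol (n + 1)}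
    (hf : f ∈ qsymIdeal (n + 1)) : rop i f ∈ qsymIdeal n := by
  have hle : qsymIdeal (n + 1) ≤ (qsymIdeal n).comap (rop i) := by
    refine Ideal.span_le.mpr fun h hh => ?_
    exact Ideal.subset_span ⟨isQSym_rop hh.1 i, by rw [constantCoeff_rop, hh.2]⟩
  exact hle hf

theorem exists_divDiff_mem_qsymIdeal {n : ℕ} (i : Fin n) {f : Pol (n + 1)}
    (hf : f ∈ qsymIdeal (n + 1)) :
    ∃ g ∈ qsymIdeal n, X i * g = rop i.succ f - rop i.castSucc f := by
  induction hf using Submodule.span_induction with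
  | mem h hh => exact ⟨0, zero_mem _, by rw [rop_eq_rop_of_isQSym hh.1 i.succ i.castSucc]; simp⟩
  | zero => exact ⟨0, zero_mem _, by simp⟩
  | add p q _ _ hp hq =>
    obtain ⟨a, ha, ha'⟩ := hp
    obtain ⟨b, hb, hb'⟩ := hq
    exact ⟨a + b, add_mem ha hb, by rw [map_add, map_add]; linear_combination ha' + hb'⟩
  | smul c p hp ih =>
    obtain ⟨a, ha, ha'⟩ := ih
    obtain ⟨e, he⟩ := X_dvd_rop_sub i c
    refine ⟨e * rop i.succ p + rop i.castSucc c * a,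
      add_mem (Ideal.mul_mem_left _ _ (rop_mem_qsymIdeal _ hp)) (Ideal.mul_mem_left _ _ ha), ?_⟩
    rw [smul_eq_mul, map_mul, map_mul]
    linear_combination rop i.castSucc c * ha' - rop i.succ p * he

/-- Adds `m` new variables in front of the first one. -/
noncomputable def pad {n m N : ℕ} (h : n + m = N) : Pol n →ₐ[ℤ] Pol N :=
  rename fun i => ⟨i + m, by omega⟩

theorem pad_X {n m N : ℕ} (h : n + m = N) (i : Fin n) :
    pad h (X i) = X ⟨i + m, by omega⟩ := by simp [pad]

theorem pad_shift {n m N : ℕ} (h : n + 1 + m = N) (p : Pol n) :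
    pad h (shift n p) = pad (show n + (m + 1) = N by omega) p := by
  refine DFunLike.congr_fun (f := (pad h).comp (shift n)) ?_ p
  ext1 j
  rw [AlgHom.comp_apply, shift_X, pad_X, pad_X]
  congr 2
  simp only [Fin.val_succ]
  omega

theorem rop_pad {n m N : ℕ} (h : n + (m + 1) = N + 1) (i : Fin (N + 1)) (hi : (i : ℕ) ≤ m)
    (p : Pol n) : rop i (pad h p) = pad (show n + m = N by omega) p := by
  refine DFunLike.congr_fun (f := (rop i).comp (pad h)) ?_ p
  ext1 j
  have hj : (⟨j + (m + 1), by omega⟩ : Fin (N + 1)) =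
      i.succAbove ⟨j + m, by omega⟩ := by
    rw [Fin.succAbove_of_le_castSucc _ _ (by simp [Fin.le_def]; omega)]
    ext
    simp [add_assoc]
  rw [AlgHom.comp_apply, pad_X, pad_X, hj, rop_X_succAbove]

theorem eq_zero_of_mem_dyck {K : ∀ n, Pol n → Prop} (h0 : ∀ f, K 0 f → f = 0)
    (hr : ∀ n (i : Fin (n + 1)) f, K (n + 1) f → K n (rop i f))
    (ht : ∀ n (i : Fin n) f g, K (n + 1) f → X i * g = rop i.succ f - rop i.castSucc f → K n g)
    {N n m : ℕ} (h : n + m = N) {g : Pol n} (hg : g ∈ dyck n m) (hK : K N (pad h g)) :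
    g = 0 := by
  induction N generalizing n m with
  | zero =>
    obtain ⟨rfl, rfl⟩ : n = 0 ∧ m = 0 := by omega
    have := h0 _ hK
    exact (map_eq_zero_iff _ (rename_injective _ fun i => i.elim0)).mp this
  | succ N ihN =>
    induction n generalizing m with
    | zero =>
      refine ihN (m := N) (by omega) (by rw [dyck]; trivial) ?_
      obtain rfl : m = N + 1 := by omega
      have := hr N 0 _ hK
      rwa [rop_pad h 0 (by simp)] at this
    | succ n ihn =>
      cases m with
      | zero =>
        rw [dyck] at hg
        obtain ⟨p, hp, rfl⟩ := hg
        change K _ (pad h (shift n p)) at hK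
        rw [pad_shift] at hK
        rw [ihn _ hp hK, map_zero]
      | succ m =>
        rw [dyck] at hg
        obtain ⟨_, ⟨p, hp, rfl⟩, _, ⟨q, hq, rfl⟩, rfl⟩ := Submodule.mem_sup.mp hg
        rw [AlgHom.toLinearMap_apply, LinearMap.mulLeft_apply] at hK ⊢
        have hm : m < N := by omega
        have hq0 : -q = 0 := by
          refine ihN (show n + 1 + m = N by omega) (neg_mem hq)
            (ht _ ⟨m, hm⟩ _ _ hK ?_)
          have hX : pad h (X 0) = X (Fin.succ ⟨m, hm⟩) := by
            rw [pad_X]; congr 1; ext; simp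
          have hX' : pad (show n + 1 + m = N by omega) (X 0) = X ⟨m, hm⟩ := by
            rw [pad_X]; congr 1; ext; simp
          rw [rop_pad h (Fin.castSucc ⟨m, hm⟩) (by simp), map_add (pad h), map_mul (pad h), hX,
            map_add (rop _), map_mul (rop _), rop_X_self, pad_shift,
            rop_pad _ (Fin.succ ⟨m, hm⟩) (by simp), map_add, map_mul, hX', pad_shift, map_neg]
          ring
        rw [neg_eq_zero] at hq0
        subst hq0
        rw [mul_zero, add_zero] at hK ⊢
        rw [pad_shift] at hK
        rw [ihn _ hp hK, map_zero]

/-! ### Comparison with the operators on infinitely many variables -/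

theorem Rop_emb {n : ℕ} (i : Fin (n + 1)) (f : Pol (n + 1)) :
    Rop (i : ℕ).succPNat (emb (n + 1) f) = emb n (rop i f) := by
  refine DFunLike.congr_fun (f := (Rop (i : ℕ).succPNat).comp (emb (n + 1)))
    (g := (emb n).comp (rop i)) ?_ f
  ext1 j
  induction j using i.succAboveCases with
  | x => simp [Rop, emb]
  | p j =>
    simp only [AlgHom.comp_apply, rop_X_succAbove, emb, rename_X, Rop, aeval_X]
    rcases Fin.castSucc_lt_or_lt_succ i j with hj | hj
    · rw [Fin.succAbove_of_castSucc_lt _ _ hj, if_pos]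
      · simp
      · rw [← PNat.coe_lt_coe]
        simpa [Fin.lt_def] using hj
    · rw [Fin.succAbove_of_lt_succ _ _ hj, if_neg, if_neg]
      · congr 1
      · intro h
        have := congrArg PNat.val h
        simp [Fin.lt_def] at this hj
        omega
      · rw [← PNat.coe_lt_coe]
        simp [Fin.lt_def] at hj ⊢
        omega

theorem divDiff_emb {T : ℕ+ → PolyP →ₗ[ℤ] PolyP}
    (hT : ∀ (i : ℕ+) (f : PolyP), (X i : PolyP) * T i f = Rop (i + 1) f - Rop i f)
    {n : ℕ} (i : Fin n) {f : Pol (n + 1)} {g : Pol n}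
    (hg : X i * g = rop i.succ f - rop i.castSucc f) :
    T (i : ℕ).succPNat (emb (n + 1) f) = emb n g := by
  refine mul_left_cancel₀ (X_ne_zero (R := ℤ) (i : ℕ).succPNat) ?_
  rw [hT]
  have h₁ := Rop_emb i.succ f
  have h₂ := Rop_emb i.castSucc f
  have h₃ := congrArg (emb n) hg
  have h₄ : emb n (X i) = X (i : ℕ).succPNat := by simp [emb]
  rw [map_mul, map_sub, ← h₁, ← h₂, h₄] at h₃
  exact h₃.symm

theorem validSeq_concat {n : ℕ} {L : List RTLetter} {x : RTLetter} :
    validSeq (n + 1) (L ++ [x]) ↔ validSeq n L ∧ validLetter n x := by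
  constructor
  · rintro ⟨hl, hv⟩
    have hl' : L.length = n := by simpa using hl
    refine ⟨⟨hl', fun p hp => ?_⟩, ?_⟩
    · have := hv p (by simp; omega)
      rwa [List.getD_append _ _ _ _ hp] at this
    · have := hv n (by simp; omega)
      rwa [List.getD_append_right _ _ _ _ hl'.le, hl', Nat.sub_self] at this
  · rintro ⟨⟨hl, hv⟩, hx⟩
    refine ⟨by simp [hl], fun p hp => ?_⟩
    rcases Nat.lt_or_ge p L.length with h | h
    · rw [List.getD_append _ _ _ _ h]
      exact hv p h
    · obtain rfl : p = n := by simp at hp; omega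
      rwa [List.getD_append_right _ _ _ _ h, hl, Nat.sub_self]

/-- All the functionals attached to the sequences in `RTSeq_n` vanish on `f`. -/
def Vanishes (T : ℕ+ → PolyP →ₗ[ℤ] PolyP) (n : ℕ) (f : Pol n) : Prop :=
  ∀ L : List RTLetter, validSeq n L → constantCoeff (applyOps T L (emb n f)) = 0

theorem applyOps_sub (T : ℕ+ → PolyP →ₗ[ℤ] PolyP) (L : List RTLetter) (f g : PolyP) :
    applyOps T L (f - g) = applyOps T L f - applyOps T L g := by
  induction L with
  | nil => rfl
  | cons x L ih =>
    simp only [applyOps, List.foldr_cons] at ih ⊢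
    cases x <;> simp [ih]

theorem applyOps_concat (T : ℕ+ → PolyP →ₗ[ℤ] PolyP) (L : List RTLetter) (x : RTLetter)
    (f : PolyP) : applyOps T (L ++ [x]) f = applyOps T L (applyOps T [x] f) :=
  List.foldr_append

theorem Vanishes.sub {T : ℕ+ → PolyP →ₗ[ℤ] PolyP} {n : ℕ} {f g : Pol n} (hf : Vanishes T n f)
    (hg : Vanishes T n g) : Vanishes T n (f - g) := fun L hL => by
  rw [map_sub, applyOps_sub, map_sub, hf L hL, hg L hL, sub_zero]

theorem Vanishes.rop {T : ℕ+ → PolyP →ₗ[ℤ] PolyP} {n : ℕ} {f : Pol (n + 1)}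
    (hf : Vanishes T (n + 1) f) (i : Fin (n + 1)) : Vanishes T n (rop i f) := fun L hL => by
  have := hf (L ++ [.r i]) (validSeq_concat (x := .r i) |>.mpr ⟨hL, Nat.le_of_lt_succ i.2⟩)
  rw [applyOps_concat] at this
  rw [← Rop_emb]
  exact this

theorem Vanishes.divDiff {T : ℕ+ → PolyP →ₗ[ℤ] PolyP}
    (hT : ∀ (i : ℕ+) (f : PolyP), (X i : PolyP) * T i f = Rop (i + 1) f - Rop i f)
    {n : ℕ} {i : Fin n} {f : Pol (n + 1)} {g : Pol n} (hf : Vanishes T (n + 1) f)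
    (hg : X i * g = QuasisymmetricIdeal.rop i.succ f - QuasisymmetricIdeal.rop i.castSucc f) :
    Vanishes T n g := fun L hL => by
  have := hf (L ++ [.t i]) (validSeq_concat (x := .t i) |>.mpr ⟨hL, i.2⟩)
  rw [applyOps_concat] at this
  rw [← divDiff_emb hT i hg]
  exact this

theorem constantCoeff_eq_zero_of_mem_qsymIdeal {n : ℕ} {f : Pol n} (hf : f ∈ qsymIdeal n) :
    constantCoeff f = 0 := by
  have hle : qsymIdeal n ≤ RingHom.ker (constantCoeff (R := ℤ) (σ := Fin n)) :=
    Ideal.span_le.mpr fun _ hh => hh.2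
  exact hle hf

theorem vanishes_of_mem_qsymIdeal {T : ℕ+ → PolyP →ₗ[ℤ] PolyP}
    (hT : ∀ (i : ℕ+) (f : PolyP), (X i : PolyP) * T i f = Rop (i + 1) f - Rop i f)
    {n : ℕ} {f : Pol n} (hf : f ∈ qsymIdeal n) : Vanishes T n f := by
  induction n with
  | zero =>
    intro L hL
    obtain rfl := List.length_eq_zero_iff.mp hL.1
    have := constantCoeff_eq_zero_of_mem_qsymIdeal hf
    simpa [applyOps, emb, constantCoeff_rename] using this
  | succ n ih =>
    intro L hL
    rcases L.eq_nil_or_concat' with rfl | ⟨L, x, rfl⟩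
    · exact absurd hL.1 (by simp)
    · rw [validSeq_concat] at hL
      rw [applyOps_concat]
      cases x with
      | r k =>
        have := ih (rop_mem_qsymIdeal ⟨k, Nat.lt_succ_of_le hL.2⟩ hf) L hL.1
        rwa [← Rop_emb] at this
      | t k =>
        obtain ⟨g, hg, hg'⟩ := exists_divDiff_mem_qsymIdeal ⟨k, hL.2⟩ hf
        have := ih hg L hL.1
        rwa [← divDiff_emb hT _ hg'] at this

theorem eq_zero_of_vanishes_zero {T : ℕ+ → PolyP →ₗ[ℤ] PolyP} {f : Pol 0}
    (hf : Vanishes T 0 f) : f = 0 := by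
  have := hf [] ⟨rfl, by simp⟩
  rw [eq_C_of_isEmpty f] at this ⊢
  simpa [applyOps, emb] using this

theorem mem_qsymIdeal_of_vanishes {T : ℕ+ → PolyP →ₗ[ℤ] PolyP}
    (hT : ∀ (i : ℕ+) (f : PolyP), (X i : PolyP) * T i f = Rop (i + 1) f - Rop i f)
    {n : ℕ} {f : Pol n} (hf : Vanishes T n f) : f ∈ qsymIdeal n := by
  obtain ⟨d, hd, hfd⟩ := exists_dyck_sub_mem f
  have hdv : Vanishes T n d := by
    simpa using hf.sub (vanishes_of_mem_qsymIdeal hT hfd)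
  have hpad : pad (Nat.add_zero n) d = d := rename_id_apply d
  have hd0 : d = 0 := eq_zero_of_mem_dyck (K := Vanishes T) (fun _ => eq_zero_of_vanishes_zero)
    (fun _ i _ h => h.rop i) (fun _ _ _ _ h hg => h.divDiff hT hg) (Nat.add_zero n) hd
    (by rwa [hpad])
  simpa [hd0] using hfd

end QuasisymmetricIdeal

theorem stmt18 (n : ℕ) (T : ℕ+ → PolyP →ₗ[ℤ] PolyP)
    (hT : ∀ (i : ℕ+) (f : PolyP),
      (MvPolynomial.X i : PolyP) * T i f = Rop (i + 1) f - Rop i f)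
    (f : MvPolynomial (Fin n) ℤ) :
    f ∈ Ideal.span {g : MvPolynomial (Fin n) ℤ |
        IsQSym n g ∧ MvPolynomial.constantCoeff g = 0} ↔
      ∀ L : List RTLetter, validSeq n L →
        MvPolynomial.constantCoeff (applyOps T L (emb n f)) = 0 :=
  ⟨QuasisymmetricIdeal.vanishes_of_mem_qsymIdeal hT,
    QuasisymmetricIdeal.mem_qsymIdeal_of_vanishes hT⟩
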